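/- Let α be a real number with 3/4 < α ≤ 1, σ ∈ {−1, +1}, N ∈ ℕ ∪ {∞} and s ≥ 2 − 2α. There exist constants c_α ∈ (0,1) and C > 0, depending only on α and s, such that for every u₀ : ℤ → ℂ with ‖u₀‖_{H^s} ≤ R (R > 0), setting T := c_α / R², there exists a unique continuously differentiable curve u : [−T, T] → H^s with u(0) = u₀ and u'(t) = X_N(u(t)) for all t ∈ [−T, T]; moreover sup_{|t| ≤ T} ‖u(t)‖_{H^s} ≤ C ‖u₀‖_{H^s}. -/

import Mathlib

open scoped BigOperators ENNReal ComplexConjugate Classical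
open Filter Set MeasureTheory ComplexConjugate

noncomputable section

/-- `ℝ≥0∞`-valued `H^s` norm of a sequence of Fourier coefficients. -/
def hsE (s : ℝ) (u : ℤ → ℂ) : ℝ≥0∞ :=
  (∑' n : ℤ, ENNReal.ofReal (1 + |(n : ℝ)| ^ (2 * s)) * (‖u n‖₊ : ℝ≥0∞) ^ 2) ^ ((1:ℝ)/2)

/-- `ℝ≥0∞`-valued `FL^{0,1}` norm. -/
def flE (u : ℤ → ℂ) : ℝ≥0∞ := ∑' n : ℤ, (‖u n‖₊ : ℝ≥0∞)

/-- real-valued `H^s` norm. -/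
def hsR (s : ℝ) (u : ℤ → ℂ) : ℝ :=
  Real.sqrt (∑' n : ℤ, (1 + |(n : ℝ)| ^ (2 * s)) * ‖u n‖ ^ 2)

/-- real-valued `FL^{0,1}` norm. -/
def flR (u : ℤ → ℂ) : ℝ := ∑' n : ℤ, ‖u n‖

/-- The condition `|j| ≤ N` for `N ∈ ℕ ∪ {∞}`. -/
def inBall (N : ℕ∞) (j : ℤ) : Prop := (j.natAbs : ℕ∞) ≤ N

/-- The resonance function `Φ_α`. -/
def res (α : ℝ) (j₁ j₂ j₃ : ℤ) : ℝ :=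
  |(j₁ : ℝ)| ^ (2 * α) + |(j₂ : ℝ)| ^ (2 * α) - |(j₃ : ℝ)| ^ (2 * α)
    - |((j₁ + j₂ - j₃ : ℤ) : ℝ)| ^ (2 * α)

/-- The (truncated) Birkhoff vector field `X_N`. -/
def XB (α σ : ℝ) (N : ℕ∞) (u : ℤ → ℂ) : ℤ → ℂ := fun n =>
  if inBall N n then
    ∑' p : ℤ × ℤ,
      (if inBall N p.1 ∧ inBall N p.2 ∧ inBall N (p.1 + p.2 - n) ∧
          res α p.1 p.2 (p.1 + p.2 - n) ≠ 0 then
        ((-σ / res α p.1 p.2 (p.1 + p.2 - n) : ℝ) : ℂ) *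
          (u p.1 * u p.2 * conj (u (p.1 + p.2 - n)))
      else 0)
  else 0

/-- Truncation `Π_N`. -/
def trunc (N : ℕ) (u : ℤ → ℂ) : ℤ → ℂ := fun n => if n.natAbs ≤ N then u n else 0

/-- Derivative of a curve at `t`, in the `H^s` norm. -/
def HasHsDerivAt (s : ℝ) (u : ℝ → ℤ → ℂ) (d : ℤ → ℂ) (t : ℝ) : Prop :=
  Tendsto (fun h : ℝ => hsE s (fun n => (u (t + h) n - u t n) / (h : ℂ) - d n))
    (nhdsWithin 0 {(0 : ℝ)}ᶜ) (nhds 0)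

/-- Derivative of a curve at `t` within a set `A` of times, in the `H^s` norm. -/
def HasHsDerivWithinAt (s : ℝ) (u : ℝ → ℤ → ℂ) (d : ℤ → ℂ) (A : Set ℝ) (t : ℝ) : Prop :=
  Tendsto (fun h : ℝ => hsE s (fun n => (u (t + h) n - u t n) / (h : ℂ) - d n))
    (nhdsWithin 0 {h : ℝ | t + h ∈ A ∧ h ≠ 0}) (nhds 0)

/-- Continuity of a curve in the `H^s` norm. -/
def ContHs (s : ℝ) (D : ℝ → ℤ → ℂ) : Prop :=
  ∀ t : ℝ, Tendsto (fun t' => hsE s (fun n => D t' n - D t n)) (nhds t) (nhds 0)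

/-- Continuity of a curve in the `H^s` norm, on a set of times. -/
def ContHsOn (s : ℝ) (A : Set ℝ) (D : ℝ → ℤ → ℂ) : Prop :=
  ∀ t ∈ A, Tendsto (fun t' => hsE s (fun n => D t' n - D t n)) (nhdsWithin t A) (nhds 0)

/-- `u` is a global-in-time solution of `d/dt u = X_N(u)`, as a curve in `H^s`. -/
def IsSol (α σ : ℝ) (N : ℕ∞) (s : ℝ) (u : ℝ → ℤ → ℂ) : Prop :=
  ∀ t : ℝ, hsE s (u t) ≠ ⊤ ∧ HasHsDerivAt s u (XB α σ N (u t)) t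

/-- `u` solves `d/dt u = X_N(u)` on the set of times `A`, as a curve in `H^s`. -/
def IsSolOn (α σ : ℝ) (N : ℕ∞) (s : ℝ) (A : Set ℝ) (u : ℝ → ℤ → ℂ) : Prop :=
  ∀ t ∈ A, hsE s (u t) ≠ ⊤ ∧ HasHsDerivWithinAt s u (XB α σ N (u t)) A t

/-- `u` is a global-in-time continuously differentiable solution, as a curve in `H^s`. -/
def IsC1Sol (α σ : ℝ) (N : ℕ∞) (s : ℝ) (u : ℝ → ℤ → ℂ) : Prop :=
  IsSol α σ N s u ∧ ContHs s (fun t => XB α σ N (u t))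

/-- `u` is a continuously differentiable solution on the set of times `A`. -/
def IsC1SolOn (α σ : ℝ) (N : ℕ∞) (s : ℝ) (A : Set ℝ) (u : ℝ → ℤ → ℂ) : Prop :=
  IsSolOn α σ N s A u ∧ ContHsOn s A (fun t => XB α σ N (u t))

/-- integer modes in `[-N, N]`. -/
def Ifin (N : ℕ) : Finset ℤ := Finset.Icc (-(N:ℤ)) (N:ℤ)

/-- The quartic form `‖Π_N u‖⁴_{L⁴}`. -/
def qL4 (N : ℕ) (u : ℤ → ℂ) : ℝ :=
  (∑ j₁ ∈ Ifin N, ∑ j₂ ∈ Ifin N, ∑ j₃ ∈ Ifin N, ∑ j₄ ∈ Ifin N,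
    if j₁ + j₂ = j₃ + j₄ then u j₁ * u j₂ * conj (u j₃) * conj (u j₄) else 0).re

/-- `G_N(u)`, the derivative at `t = 0` of the energy along the truncated Birkhoff flow. -/
def GN (α σ : ℝ) (N : ℕ) (u : ℤ → ℂ) : ℝ :=
  -(σ/2) * qL4 N u + σ * (∑ j ∈ Ifin N, ‖u j‖^2)^2
  + 2 * σ * (∑ n₁ ∈ Ifin N, ∑ n₂ ∈ Ifin N, ∑ m₁ ∈ Ifin N, ∑ m₂ ∈ Ifin N,
      if n₁ + n₂ = m₁ + m₂ then
        XB α σ (N : ℕ∞) (trunc N u) n₁ * u n₂ * conj (u m₁) * conj (u m₂)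
      else 0).re


/-- Cauchy–Schwarz for `ℝ≥0∞`-valued series. -/
lemma ennreal_tsum_mul_sq_le {ι : Type*} (f g : ι → ℝ≥0∞) :
    (∑' i, f i * g i) ^ 2 ≤ (∑' i, f i ^ 2) * ∑' i, g i ^ 2 := by
  let _ : MeasurableSpace ι := ⊤
  have h := ENNReal.lintegral_mul_le_Lp_mul_Lq (Measure.count : Measure ι)
    Real.HolderConjugate.two_two (f := f) (g := g)
    measurable_from_top.aemeasurable measurable_from_top.aemeasurable
  simp only [lintegral_count, Pi.mul_apply, ENNReal.rpow_ofNat] at h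
  calc (∑' i, f i * g i) ^ 2
      ≤ ((∑' i, f i ^ 2) ^ (1 / 2 : ℝ) * (∑' i, g i ^ 2) ^ (1 / 2 : ℝ)) ^ 2 := by gcongr
    _ = _ := by
        rw [mul_pow, ← ENNReal.rpow_mul_natCast, ← ENNReal.rpow_mul_natCast]
        norm_num

/-- A trilinear convolution with kernel `κ ⊗ κ`, `κ ∈ ℓ²`, maps `ℓ² × ℓ² × ℓ²` to `ℓ²`. -/
lemma ennreal_trilinear_le (κ a b c : ℤ → ℝ≥0∞) :
    ∑' n : ℤ, (∑' p : ℤ × ℤ, κ (n - p.1) * κ (n - p.2) *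
        (a p.1 * b p.2 * c (p.1 + p.2 - n))) ^ 2 ≤
      (∑' k, κ k ^ 2) ^ 2 * ((∑' k, a k ^ 2) * (∑' k, b k ^ 2) * ∑' k, c k ^ 2) := by
  have hg : ∀ n : ℤ, ∑' p : ℤ × ℤ, (κ (n - p.1) * c (p.1 + p.2 - n)) ^ 2
      = (∑' k, κ k ^ 2) * ∑' k, c k ^ 2 := by
    intro n
    simp only [mul_pow]
    rw [ENNReal.tsum_prod (f := fun x y => κ (n - x) ^ 2 * c (x + y - n) ^ 2)]
    have : ∀ x : ℤ, ∑' y : ℤ, κ (n - x) ^ 2 * c (x + y - n) ^ 2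
        = κ (n - x) ^ 2 * ∑' k, c k ^ 2 := by
      intro x
      rw [ENNReal.tsum_mul_left]
      congr 1
      rw [← (Equiv.addLeft (x - n)).tsum_eq (fun k => c k ^ 2)]
      refine tsum_congr fun y => ?_
      simp only [Equiv.coe_addLeft]
      congr 2; ring
    simp_rw [this]
    rw [ENNReal.tsum_mul_right]
    congr 1
    exact (Equiv.subLeft n).tsum_eq (fun k => κ k ^ 2)
  have hf : ∑' n : ℤ, ∑' p : ℤ × ℤ, (κ (n - p.2) * (a p.1 * b p.2)) ^ 2
      = (∑' k, κ k ^ 2) * ((∑' k, a k ^ 2) * ∑' k, b k ^ 2) := by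
    rw [ENNReal.tsum_comm]
    have : ∀ p : ℤ × ℤ, ∑' n : ℤ, (κ (n - p.2) * (a p.1 * b p.2)) ^ 2
        = (∑' k, κ k ^ 2) * (a p.1 ^ 2 * b p.2 ^ 2) := by
      intro p
      simp only [mul_pow]
      rw [ENNReal.tsum_mul_right]
      congr 1
      exact (Equiv.subRight p.2).tsum_eq (fun k => κ k ^ 2)
    simp_rw [this]
    rw [ENNReal.tsum_mul_left, ENNReal.tsum_prod (f := fun x y => a x ^ 2 * b y ^ 2)]
    simp_rw [ENNReal.tsum_mul_left, ENNReal.tsum_mul_right]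
  calc _ ≤ ∑' n : ℤ, (∑' p : ℤ × ℤ, (κ (n - p.2) * (a p.1 * b p.2)) ^ 2) *
        ((∑' k, κ k ^ 2) * ∑' k, c k ^ 2) := by
        refine ENNReal.tsum_le_tsum fun n => ?_
        rw [← hg n]
        refine le_trans (le_of_eq ?_) (ennreal_tsum_mul_sq_le _ _)
        congr 1
        refine tsum_congr fun p => ?_
        ring
    _ = _ := by
        rw [ENNReal.tsum_mul_right, hf]
        ring

lemma memlp_two_iff_tsum_enorm (f : ℤ → ℂ) :
    Memℓp f 2 ↔ ∑' n, ‖f n‖ₑ ^ 2 ≠ ⊤ := by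
  rw [memℓp_gen_iff (by norm_num)]
  simp only [ENNReal.toReal_ofNat, Real.rpow_ofNat]
  have h : ∀ n, ‖f n‖ₑ ^ 2 = ((‖f n‖₊ ^ 2 : NNReal) : ℝ≥0∞) := fun n => by
    simp [enorm_eq_nnnorm]
  simp_rw [h]
  rw [ENNReal.tsum_coe_ne_top_iff_summable, ← NNReal.summable_coe]
  simp

lemma lp_two_enorm_sq (a : lp (fun _ : ℤ => ℂ) 2) : ‖a‖ₑ ^ 2 = ∑' n, ‖a n‖ₑ ^ 2 := by
  have h := lp.hasSum_norm (by norm_num) a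
  simp only [ENNReal.toReal_ofNat, Real.rpow_ofNat] at h
  have h2 : ∀ x : ℝ, 0 ≤ x → ENNReal.ofReal (x ^ 2) = ENNReal.ofReal x ^ 2 :=
    fun x hx => ENNReal.ofReal_pow hx 2
  simp_rw [← ofReal_norm]
  rw [← h2 _ (norm_nonneg a), ← h.tsum_eq, ENNReal.ofReal_tsum_of_nonneg (fun n => by positivity)
    h.summable]
  exact tsum_congr fun n => h2 _ (norm_nonneg _)

/-- The trilinear (conjugate-linear in the third slot) convolution with multiplier `m`. -/
def tri (m : ℤ → ℤ × ℤ → ℂ) (a b c : ℤ → ℂ) (n : ℤ) : ℂ :=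
  ∑' p : ℤ × ℤ, m n p * (a p.1 * b p.2 * conj (c (p.1 + p.2 - n)))

section Trilinear

variable {m : ℤ → ℤ × ℤ → ℂ} {κ : ℤ → ℝ≥0∞}

lemma tsum_tsum_enorm_sq_le (hm : ∀ n p, ‖m n p‖ₑ ≤ κ (n - p.1) * κ (n - p.2))
    (a b c : lp (fun _ : ℤ => ℂ) 2) :
    ∑' n : ℤ, (∑' p : ℤ × ℤ, ‖m n p * (a p.1 * b p.2 * conj (c (p.1 + p.2 - n)))‖ₑ) ^ 2 ≤
      ((∑' k, κ k ^ 2) * (‖a‖ₑ * ‖b‖ₑ * ‖c‖ₑ)) ^ 2 := by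
  rw [mul_pow, mul_pow, mul_pow, lp_two_enorm_sq, lp_two_enorm_sq, lp_two_enorm_sq]
  refine le_trans ?_ (ennreal_trilinear_le κ _ _ _)
  gcongr with n p
  rw [enorm_mul, enorm_mul, enorm_mul, RCLike.enorm_conj]
  gcongr
  exact hm n p

lemma summable_tri (hm : ∀ n p, ‖m n p‖ₑ ≤ κ (n - p.1) * κ (n - p.2))
    (hκ : ∑' k, κ k ^ 2 ≠ ⊤) (a b c : lp (fun _ : ℤ => ℂ) 2) (n : ℤ) :
    Summable fun p : ℤ × ℤ => m n p * (a p.1 * b p.2 * conj (c (p.1 + p.2 - n))) := by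
  have h : (∑' p : ℤ × ℤ, ‖m n p * (a p.1 * b p.2 * conj (c (p.1 + p.2 - n)))‖ₑ) ^ 2 ≠ ⊤ := by
    refine ne_top_of_le_ne_top ?_ ((ENNReal.le_tsum n).trans (tsum_tsum_enorm_sq_le hm a b c))
    finiteness
  rw [ne_eq, ENNReal.pow_eq_top_iff] at h
  push Not at h
  have h2 := mt h (by norm_num)
  simp_rw [enorm_eq_nnnorm] at h2
  exact Summable.of_nnnorm (ENNReal.tsum_coe_ne_top_iff_summable.mp h2)

lemma tsum_enorm_tri_sq_le (hm : ∀ n p, ‖m n p‖ₑ ≤ κ (n - p.1) * κ (n - p.2))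
    (a b c : lp (fun _ : ℤ => ℂ) 2) :
    ∑' n : ℤ, ‖tri m a b c n‖ₑ ^ 2 ≤ ((∑' k, κ k ^ 2) * (‖a‖ₑ * ‖b‖ₑ * ‖c‖ₑ)) ^ 2 := by
  refine le_trans ?_ (tsum_tsum_enorm_sq_le hm a b c)
  gcongr with n
  exact enorm_tsum_le_tsum_enorm

lemma exists_lp_eq_tri (hm : ∀ n p, ‖m n p‖ₑ ≤ κ (n - p.1) * κ (n - p.2))
    (hκ : ∑' k, κ k ^ 2 ≠ ⊤) (a b c : lp (fun _ : ℤ => ℂ) 2) :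
    ∃ y : lp (fun _ : ℤ => ℂ) 2, (∀ n, y n = tri m a b c n) ∧
      ‖y‖ ≤ (∑' k, κ k ^ 2).toReal * (‖a‖ * ‖b‖ * ‖c‖) := by
  have h := tsum_enorm_tri_sq_le hm a b c
  have hfin : ((∑' k, κ k ^ 2) * (‖a‖ₑ * ‖b‖ₑ * ‖c‖ₑ)) ≠ ⊤ := by finiteness
  refine ⟨⟨tri m a b c, (memlp_two_iff_tsum_enorm _).mpr
    (ne_top_of_le_ne_top (by finiteness) h)⟩, fun n => rfl, ?_⟩
  set y : lp (fun _ : ℤ => ℂ) 2 := ⟨tri m a b c, _⟩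
  have h2 : ‖y‖ₑ ≤ (∑' k, κ k ^ 2) * (‖a‖ₑ * ‖b‖ₑ * ‖c‖ₑ) := by
    rw [← ENNReal.pow_le_pow_left_iff two_ne_zero, lp_two_enorm_sq]
    exact h
  have h3 := ENNReal.toReal_mono hfin h2
  simpa [ENNReal.toReal_mul] using h3

/-- The cubic vector field on `ℓ²` attached to a multiplier dominated by `κ ⊗ κ`. -/
lemma exists_cubic_field (hm : ∀ n p, ‖m n p‖ₑ ≤ κ (n - p.1) * κ (n - p.2))
    (hκ : ∑' k, κ k ^ 2 ≠ ⊤) :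
    ∃ Y : lp (fun _ : ℤ => ℂ) 2 → lp (fun _ : ℤ => ℂ) 2,
      (∀ a n, Y a n = tri m a a a n) ∧
      (∀ a b, ‖Y a - Y b‖ ≤ (∑' k, κ k ^ 2).toReal *
        ((‖a‖ ^ 2 + ‖a‖ * ‖b‖ + ‖b‖ ^ 2) * ‖a - b‖)) ∧ Y 0 = 0 := by
  choose F hF hFn using exists_lp_eq_tri hm hκ
  refine ⟨fun a => F a a a, fun a n => hF a a a n, fun a b => ?_, ?_⟩
  · have key : F a a a - F b b b = F (a - b) a a + F b (a - b) a + F b b (a - b) := by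
      ext n
      simp only [lp.coeFn_sub, lp.coeFn_add, Pi.sub_apply, Pi.add_apply, hF, tri]
      have s1 := summable_tri hm hκ a a a n
      have s2 := summable_tri hm hκ b b b n
      have s3 := summable_tri hm hκ (a - b) a a n
      have s4 := summable_tri hm hκ b (a - b) a n
      have s5 := summable_tri hm hκ b b (a - b) n
      simp only [lp.coeFn_sub, Pi.sub_apply] at s3 s4 s5
      rw [← s1.tsum_sub s2, ← s3.tsum_add s4, ← (s3.add s4).tsum_add s5]
      refine tsum_congr fun p => ?_
      simp only [map_sub]
      ring
    rw [key]
    calc _ ≤ ‖F (a - b) a a‖ + ‖F b (a - b) a‖ + ‖F b b (a - b)‖ := norm_add₃_le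
      _ ≤ _ := by
        have h1 := hFn (a - b) a a
        have h2 := hFn b (a - b) a
        have h3 := hFn b b (a - b)
        linarith
  · have h := hFn 0 0 0
    simpa using h

end Trilinear

/-- Four-point inequality for convex functions. -/
lemma ConvexOn.add_le_add_of_nonneg {S : Set ℝ} {g : ℝ → ℝ} (hg : ConvexOn ℝ S g)
    {x h l : ℝ} (hh : 0 ≤ h) (hl : 0 ≤ l) (hx : x ∈ S) (hy : x + h + l ∈ S) :
    g (x + h) + g (x + l) ≤ g x + g (x + h + l) := by
  rcases (add_nonneg hh hl).eq_or_lt with h0 | h0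
  · have h1 : h = 0 := by linarith
    have h2 : l = 0 := by linarith
    subst h1 h2
    simp
  · have e1 := hg.2 hx hy (by positivity : 0 ≤ l / (h + l)) (by positivity : 0 ≤ h / (h + l))
      (by field_simp; ring)
    have e2 := hg.2 hx hy (by positivity : 0 ≤ h / (h + l)) (by positivity : 0 ≤ l / (h + l))
      (by field_simp)
    simp only [smul_eq_mul] at e1 e2
    have r1 : l / (h + l) * x + h / (h + l) * (x + h + l) = x + h := by field_simp; ring
    have r2 : h / (h + l) * x + l / (h + l) * (x + h + l) = x + l := by field_simp; ring
    rw [r1] at e1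
    rw [r2] at e2
    have r3 : l / (h + l) = 1 - h / (h + l) := by field_simp; ring
    rw [r3] at e1 e2
    linarith

lemma convexOn_abs_rpow_sub_sq {p M : ℝ} (hp : 3 / 2 < p) (hp2 : p ≤ 2) (hM : 0 < M) :
    ConvexOn ℝ (Icc (-M) M) fun x => |x| ^ p - 1 / 4 * M ^ (p - 2) * |x| ^ 2 := by
  have himg : (fun x : ℝ => |x|) '' Icc (-M) M = Icc 0 M := by
    ext y
    constructor
    · rintro ⟨x, hx, rfl⟩
      exact ⟨abs_nonneg x, abs_le.mpr hx⟩
    · intro hy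
      exact ⟨y, ⟨by linarith [hy.1], hy.2⟩, abs_of_nonneg hy.1⟩
  have habs : ConvexOn ℝ (Icc (-M) M) fun x : ℝ => |x| :=
    convexOn_norm (E := ℝ) (convex_Icc (-M) M)
  set c : ℝ := 1 / 4 * M ^ (p - 2) with hc
  have hcont : ContinuousOn (fun x : ℝ => x ^ p - c * x ^ 2) (Icc 0 M) := by
    have : Continuous fun x : ℝ => x ^ p := Real.continuous_rpow_const (by linarith)
    fun_prop
  have hd1 : ∀ x ∈ Ioo (0 : ℝ) M, HasDerivAt (fun x : ℝ => x ^ p - c * x ^ 2)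
      (p * x ^ (p - 1) - c * (2 * x)) x := by
    intro x hx
    have := (Real.hasDerivAt_rpow_const (p := p) (Or.inl hx.1.ne')).sub
      (((hasDerivAt_id x).pow 2).const_mul c)
    exact this.congr_deriv (by simp)
  have hd2 : ∀ x ∈ Ioo (0 : ℝ) M, HasDerivAt (fun x : ℝ => p * x ^ (p - 1) - c * (2 * x))
      (p * ((p - 1) * x ^ (p - 2)) - c * 2) x := by
    intro x hx
    have := ((Real.hasDerivAt_rpow_const (p := p - 1) (Or.inl hx.1.ne')).const_mul p).sub
      (((hasDerivAt_id x).const_mul 2).const_mul c)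
    have e : p - 1 - 1 = p - 2 := by ring
    exact this.congr_deriv (by simp [e])
  have hpow : ∀ x ∈ Ioo (0 : ℝ) M, 4 * c ≤ x ^ (p - 2) := by
    intro x hx
    have := Real.rpow_le_rpow_of_nonpos hx.1 hx.2.le (by linarith : p - 2 ≤ 0)
    rw [hc]; linarith
  have hc0 : 0 < c := by positivity
  refine ConvexOn.comp (g := fun x : ℝ => x ^ p - c * x ^ 2) (f := fun x : ℝ => |x|)
    ?_ habs ?_
  · rw [himg]
    refine convexOn_of_hasDerivWithinAt2_nonneg (convex_Icc 0 M) hcont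
      (f' := fun x => p * x ^ (p - 1) - c * (2 * x))
      (f'' := fun x => p * ((p - 1) * x ^ (p - 2)) - c * 2) ?_ ?_ ?_
    · rw [interior_Icc]
      exact fun x hx => (hd1 x hx).hasDerivWithinAt
    · rw [interior_Icc]
      exact fun x hx => (hd2 x hx).hasDerivWithinAt
    · rw [interior_Icc]
      intro x hx
      have h1 := hpow x hx
      have h2 : 3 / 4 ≤ p * (p - 1) := by nlinarith
      have h3 : 3 / 4 * (4 * c) ≤ p * (p - 1) * x ^ (p - 2) := by gcongr
      nlinarith
  · rw [himg]
    refine monotoneOn_of_hasDerivWithinAt_nonneg (convex_Icc 0 M) hcont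
      (f' := fun x => p * x ^ (p - 1) - c * (2 * x)) ?_ ?_
    · rw [interior_Icc]
      exact fun x hx => (hd1 x hx).hasDerivWithinAt
    · rw [interior_Icc]
      intro x hx
      have h1 := hpow x hx
      have e : x ^ (p - 1) = x ^ (p - 2) * x := by
        rw [← Real.rpow_add_one hx.1.ne']; congr 1; ring
      simp only [e]
      have h0 := hx.1
      have h3 : 3 / 2 * (4 * c) * x ≤ p * x ^ (p - 2) * x := by gcongr
      nlinarith [mul_pos hc0 h0]

lemma mul_abs_le_abs_second_difference {p M a k l : ℝ} (hp : 3 / 2 < p) (hp2 : p ≤ 2)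
    (hM : 0 < M) (h0 : |a| ≤ M) (hk : |a + k| ≤ M) (hl : |a + l| ≤ M) (hkl : |a + k + l| ≤ M) :
    1 / 2 * M ^ (p - 2) * (|k| * |l|) ≤
      abs (|a + k| ^ p + |a + l| ^ p - |a| ^ p - |a + k + l| ^ p) := by
  have hg := convexOn_abs_rpow_sub_sq hp hp2 hM
  have hc0 : 0 < M ^ (p - 2) := by positivity
  set c := M ^ (p - 2)
  rw [← abs_mul]
  rw [abs_le] at h0 hk hl hkl
  rcases le_total 0 k with h1 | h1 <;> rcases le_total 0 l with h2 | h2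
  · have := hg.add_le_add_of_nonneg h1 h2 h0 hkl
    simp only [sq_abs] at this
    rw [abs_of_nonneg (mul_nonneg h1 h2)]
    refine le_trans ?_ (neg_le_abs _)
    linarith
  · have := hg.add_le_add_of_nonneg (x := a + l) h1 (neg_nonneg.mpr h2) hl
      (by rw [show a + l + k + -l = a + k by ring]; exact hk)
    rw [show a + l + k + -l = a + k by ring, show a + l + k = a + k + l by ring,
      show a + l + -l = a by ring] at this
    simp only [sq_abs] at this
    rw [abs_of_nonpos (mul_nonpos_of_nonneg_of_nonpos h1 h2)]
    refine le_trans ?_ (le_abs_self _)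
    linarith
  · have := hg.add_le_add_of_nonneg (x := a + k) h2 (neg_nonneg.mpr h1) hk
      (by rw [show a + k + l + -k = a + l by ring]; exact hl)
    rw [show a + k + l + -k = a + l by ring, show a + k + -k = a by ring] at this
    simp only [sq_abs] at this
    rw [abs_of_nonpos (mul_nonpos_of_nonpos_of_nonneg h1 h2)]
    refine le_trans ?_ (le_abs_self _)
    linarith
  · have := hg.add_le_add_of_nonneg (x := a + k + l) (neg_nonneg.mpr h1) (neg_nonneg.mpr h2) hkl
      (by rw [show a + k + l + -k + -l = a by ring]; exact h0)
    rw [show a + k + l + -k + -l = a by ring, show a + k + l + -k = a + l by ring,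
      show a + k + l + -l = a + k by ring] at this
    simp only [sq_abs] at this
    rw [abs_of_nonneg (mul_nonneg_of_nonpos_of_nonpos h1 h2)]
    refine le_trans ?_ (neg_le_abs _)
    linarith

/-- Lower bound for the resonance function. -/
lemma mul_abs_le_abs_res {α : ℝ} (hα₁ : 3 / 4 < α) (hα₂ : α ≤ 1) (i j l : ℤ) :
    |(i : ℝ) - l| * |(j : ℝ) - l| ≤
      2 * (1 + |(i : ℝ)| + |(j : ℝ)| + |(l : ℝ)|) ^ (2 - 2 * α) * |res α i j l| := by
  set M : ℝ := 1 + |(i : ℝ)| + |(j : ℝ)| + |(l : ℝ)| with hM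
  have hM0 : 0 < M := by positivity
  have hi := abs_nonneg (i : ℝ)
  have hj := abs_nonneg (j : ℝ)
  have hl := abs_nonneg (l : ℝ)
  have h := mul_abs_le_abs_second_difference (p := 2 * α) (a := (l : ℝ)) (k := i - l) (l := j - l)
    (by linarith) (by linarith) hM0 (by linarith)
    (by rw [add_sub_cancel]; linarith) (by rw [add_sub_cancel]; linarith)
    (by
      rw [add_sub_cancel]
      have h1 := abs_add_le (i : ℝ) (j - l)
      have h2 := abs_sub (j : ℝ) l
      linarith)
  have e : abs (|(l : ℝ) + (i - l)| ^ (2 * α) + |(l : ℝ) + (j - l)| ^ (2 * α) - |(l : ℝ)| ^ (2 * α)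
      - |(l : ℝ) + (i - l) + (j - l)| ^ (2 * α)) = |res α i j l| := by
    rw [res]
    push_cast
    rw [add_sub_cancel, add_sub_cancel, add_sub_assoc (i : ℝ) j l]
  rw [e] at h
  have e2 : M ^ (2 - 2 * α) * M ^ (2 * α - 2) = 1 := by
    rw [← Real.rpow_add hM0]; simp
  calc |(i : ℝ) - l| * |(j : ℝ) - l|
      = 2 * M ^ (2 - 2 * α) * (1 / 2 * M ^ (2 * α - 2) * (|(i : ℝ) - l| * |(j : ℝ) - l|)) := by
        linear_combination -(|(i : ℝ) - l| * |(j : ℝ) - l|) * e2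
    _ ≤ _ := by gcongr

/-- The weight defining the `H^s` norm. -/
def hsWeight (s : ℝ) (n : ℤ) : ℝ := Real.sqrt (1 + |(n : ℝ)| ^ (2 * s))

lemma hsWeight_pos (s : ℝ) (n : ℤ) : 0 < hsWeight s n :=
  Real.sqrt_pos.mpr (by positivity)

lemma hsWeight_le {s : ℝ} (hs : 0 ≤ s) (n : ℤ) :
    hsWeight s n ≤ 2 * (1 + |(n : ℝ)|) ^ s := by
  rw [hsWeight, Real.sqrt_le_left (by positivity)]
  have h1 : |(n : ℝ)| ^ (2 * s) ≤ (1 + |(n : ℝ)|) ^ (2 * s) := by gcongr; linarith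
  have h2 : 1 ≤ (1 + |(n : ℝ)|) ^ (2 * s) :=
    Real.one_le_rpow (by linarith [abs_nonneg (n : ℝ)]) (by linarith)
  have h3 : ((1 + |(n : ℝ)|) ^ s) ^ 2 = (1 + |(n : ℝ)|) ^ (2 * s) := by
    rw [← Real.rpow_mul_natCast (by positivity)]; congr 1; push_cast; ring
  rw [mul_pow, h3]
  linarith

lemma le_hsWeight {s : ℝ} (hs : 0 ≤ s) (n : ℤ) :
    (1 + |(n : ℝ)|) ^ s ≤ 2 ^ s * hsWeight s n := by
  have h0 : (1 + |(n : ℝ)|) ^ s ≤ (2 * max 1 |(n : ℝ)|) ^ s := by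
    gcongr
    linarith [le_max_left 1 |(n : ℝ)|, le_max_right 1 |(n : ℝ)|]
  rw [Real.mul_rpow (by norm_num) (by positivity)] at h0
  refine h0.trans ?_
  gcongr
  rw [hsWeight]
  apply Real.le_sqrt_of_sq_le
  rw [← Real.rpow_mul_natCast (by positivity), show s * ((2 : ℕ) : ℝ) = 2 * s by push_cast; ring]
  rcases le_total 1 |(n : ℝ)| with h | h
  · rw [max_eq_right h]; linarith
  · rw [max_eq_left h, Real.one_rpow]
    have : 0 ≤ |(n : ℝ)| ^ (2 * s) := by positivity
    linarith

lemma rpow_mul_rpow_le {s γ A B D K Jn M : ℝ} (hγ : 0 ≤ γ) (hs : γ ≤ s) (hA : 1 ≤ A) (hB : 1 ≤ B)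
    (hD : 1 ≤ D) (hK : 0 < K) (hJn : 0 ≤ Jn) (hM : 0 ≤ M) (h1 : Jn ≤ 3 * A) (h2 : M ≤ 3 * A)
    (h3 : A ≤ 2 * K * B) :
    Jn ^ s * M ^ γ ≤ 3 ^ s * 6 ^ γ * K ^ γ * (A ^ s * B ^ s * D ^ s) := by
  have hs0 : 0 ≤ s := hγ.trans hs
  have e1 : Jn ^ s ≤ 3 ^ s * A ^ s := by
    rw [← Real.mul_rpow (by norm_num) (by linarith)]; gcongr
  have e2 : M ^ γ ≤ 6 ^ γ * K ^ γ * B ^ γ := by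
    rw [← Real.mul_rpow (by norm_num) hK.le, ← Real.mul_rpow (by positivity) (by linarith)]
    gcongr
    linarith
  have e3 : B ^ γ ≤ B ^ s := Real.rpow_le_rpow_of_exponent_le hB hs
  have e4 : 1 ≤ D ^ s := Real.one_le_rpow hD hs0
  calc Jn ^ s * M ^ γ ≤ (3 ^ s * A ^ s) * (6 ^ γ * K ^ γ * B ^ s) := by
        gcongr
        exact e2.trans (by gcongr)
    _ = 3 ^ s * 6 ^ γ * K ^ γ * (A ^ s * B ^ s * 1) := by ring
    _ ≤ _ := by gcongr

lemma abs_int_sub_ge_one {i l : ℤ} (h : i ≠ l) : 1 ≤ |(i : ℝ) - l| := by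
  have : 1 ≤ |i - l| := Int.one_le_abs (sub_ne_zero.mpr h)
  exact_mod_cast this

lemma rpow_jap_mul_le {s γ : ℝ} (hγ : 0 ≤ γ) (hs : γ ≤ s) {i j l : ℤ} (hi : i ≠ l) (hj : j ≠ l) :
    (1 + |((i + j - l : ℤ) : ℝ)|) ^ s * (1 + |(i : ℝ)| + |(j : ℝ)| + |(l : ℝ)|) ^ γ ≤
      3 ^ s * 6 ^ γ * (|(i : ℝ) - l| * |(j : ℝ) - l|) ^ γ *
        ((1 + |(i : ℝ)|) ^ s * (1 + |(j : ℝ)|) ^ s * (1 + |(l : ℝ)|) ^ s) := by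
  have k1 := abs_int_sub_ge_one hi
  have k2 := abs_int_sub_ge_one hj
  have ai := abs_nonneg (i : ℝ)
  have aj := abs_nonneg (j : ℝ)
  have al := abs_nonneg (l : ℝ)
  have hn : |((i + j - l : ℤ) : ℝ)| ≤ |(i : ℝ)| + |(j : ℝ)| + |(l : ℝ)| := by
    push_cast
    have h1 := abs_sub ((i : ℝ) + j) l
    have h2 := abs_add_le (i : ℝ) j
    linarith
  have il : |(i : ℝ)| ≤ |(i : ℝ) - l| + |(l : ℝ)| := by
    simpa using abs_add_le ((i : ℝ) - l) l
  have jl : |(j : ℝ)| ≤ |(j : ℝ) - l| + |(l : ℝ)| := by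
    simpa using abs_add_le ((j : ℝ) - l) l
  have li : |(l : ℝ)| ≤ |(i : ℝ) - l| + |(i : ℝ)| := by
    have := abs_add_le ((l : ℝ) - i) i
    rw [abs_sub_comm (l : ℝ) i] at this
    simpa using this
  set x := |(i : ℝ) - l|
  set y := |(j : ℝ) - l|
  have hx : x ≤ x * y := by nlinarith
  have hy : y ≤ x * y := by nlinarith
  have hK : 1 ≤ x * y := by linarith
  have hn0 := abs_nonneg (((i + j - l : ℤ) : ℝ))
  have aux : ∀ A B k : ℝ, k ≤ x * y → 0 ≤ B → A ≤ k + B → 1 + A ≤ 2 * (x * y) * (1 + B) := by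
    intro A B k h1 h2 h3
    nlinarith
  rcases le_total |(i : ℝ)| |(l : ℝ)| with c1 | c1 <;>
    rcases le_total |(j : ℝ)| |(l : ℝ)| with c2 | c2 <;>
    rcases le_total |(i : ℝ)| |(j : ℝ)| with c3 | c3
  all_goals first
    | (refine (rpow_mul_rpow_le (A := 1 + |(l : ℝ)|) (B := 1 + |(i : ℝ)|) (D := 1 + |(j : ℝ)|)
        (K := x * y) hγ hs (by linarith) (by linarith) (by linarith) (by linarith) (by linarith)
        (by linarith) (by linarith) (by linarith) (aux _ _ x hx ai li)).trans
        (le_of_eq ?_)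
       ring)
    | (refine (rpow_mul_rpow_le (A := 1 + |(i : ℝ)|) (B := 1 + |(l : ℝ)|) (D := 1 + |(j : ℝ)|)
        (K := x * y) hγ hs (by linarith) (by linarith) (by linarith) (by linarith) (by linarith)
        (by linarith) (by linarith) (by linarith) (aux _ _ x hx al il)).trans
        (le_of_eq ?_)
       ring)
    | (refine (rpow_mul_rpow_le (A := 1 + |(j : ℝ)|) (B := 1 + |(l : ℝ)|) (D := 1 + |(i : ℝ)|)
        (K := x * y) hγ hs (by linarith) (by linarith) (by linarith) (by linarith) (by linarith)
        (by linarith) (by linarith) (by linarith) (aux _ _ y hy al jl)).trans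
        (le_of_eq ?_)
       ring)

/-- Pointwise bound for the weighted multiplier of the Birkhoff vector field. -/
lemma exists_hsWeight_le {α s : ℝ} (hα₁ : 3 / 4 < α) (hα₂ : α ≤ 1) (hs : 2 - 2 * α ≤ s) :
    ∃ C : ℝ, 0 < C ∧ ∀ i j l : ℤ, res α i j l ≠ 0 →
      hsWeight s (i + j - l) ≤ C * (|(i : ℝ) - l| ^ (1 - 2 * α) * |(j : ℝ) - l| ^ (1 - 2 * α)) *
        (hsWeight s i * hsWeight s j * hsWeight s l) * |res α i j l| := by
  have hγ : 0 ≤ 2 - 2 * α := by linarith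
  have hs0 : 0 ≤ s := hγ.trans hs
  refine ⟨4 * (3 ^ s * 6 ^ (2 - 2 * α)) * (2 ^ s * 2 ^ s * 2 ^ s), by positivity,
    fun i j l hres => ?_⟩
  have hi : i ≠ l := by rintro rfl; apply hres; simp [res]
  have hj : j ≠ l := by rintro rfl; apply hres; simp [res]
  have k1 := abs_int_sub_ge_one hi
  have k2 := abs_int_sub_ge_one hj
  have h1 := rpow_jap_mul_le hγ hs hi hj
  have h2 := mul_abs_le_abs_res hα₁ hα₂ i j l
  have hW := hsWeight_le hs0 (i + j - l)
  have h3 := le_hsWeight hs0 i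
  have h4 := le_hsWeight hs0 j
  have h5 := le_hsWeight hs0 l
  have p1 := hsWeight_pos s i
  have p2 := hsWeight_pos s j
  set x := |(i : ℝ) - l|
  set y := |(j : ℝ) - l|
  set M := 1 + |(i : ℝ)| + |(j : ℝ)| + |(l : ℝ)|
  have hxy : 0 < x * y := by nlinarith
  have e : (x * y) ^ (2 - 2 * α) = (x ^ (1 - 2 * α) * y ^ (1 - 2 * α)) * (x * y) := by
    rw [← Real.mul_rpow (by linarith) (by linarith), ← Real.rpow_add_one hxy.ne']
    congr 1; ring
  have hstep : (x * y) * hsWeight s (i + j - l) ≤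
      (x * y) * (4 * (3 ^ s * 6 ^ (2 - 2 * α)) * (2 ^ s * 2 ^ s * 2 ^ s) *
        (x ^ (1 - 2 * α) * y ^ (1 - 2 * α)) *
        (hsWeight s i * hsWeight s j * hsWeight s l) * |res α i j l|) := by
    calc (x * y) * hsWeight s (i + j - l)
        ≤ (2 * M ^ (2 - 2 * α) * |res α i j l|) * (2 * (1 + |((i + j - l : ℤ) : ℝ)|) ^ s) := by
          gcongr
          exact (hsWeight_pos s _).le
      _ = 4 * ((1 + |((i + j - l : ℤ) : ℝ)|) ^ s * M ^ (2 - 2 * α)) * |res α i j l| := by ring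
      _ ≤ 4 * (3 ^ s * 6 ^ (2 - 2 * α) * (x * y) ^ (2 - 2 * α) *
          ((2 ^ s * hsWeight s i) * (2 ^ s * hsWeight s j) * (2 ^ s * hsWeight s l))) *
          |res α i j l| := by
          refine mul_le_mul_of_nonneg_right (mul_le_mul_of_nonneg_left (h1.trans ?_) (by norm_num))
            (abs_nonneg _)
          gcongr
      _ = _ := by rw [e]; ring
  exact le_of_mul_le_mul_left hstep hxy

section CubicODE

variable {E : Type*} [NormedAddCommGroup E] {Y : E → E} {B : ℝ}

lemma lipschitzOnWith_of_cubic (hB : 0 ≤ B)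
    (hY : ∀ a b, ‖Y a - Y b‖ ≤ B * ((‖a‖ ^ 2 + ‖a‖ * ‖b‖ + ‖b‖ ^ 2) * ‖a - b‖)) (r : ℝ) :
    LipschitzOnWith (3 * B * r ^ 2).toNNReal Y {x | ‖x‖ ≤ r} := by
  refine LipschitzOnWith.of_dist_le_mul fun x hx y hy => ?_
  change ‖x‖ ≤ r at hx
  change ‖y‖ ≤ r at hy
  rw [dist_eq_norm, dist_eq_norm, Real.coe_toNNReal _ (by positivity)]
  refine (hY x y).trans ?_
  have hr : 0 ≤ r := (norm_nonneg x).trans hx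
  calc B * ((‖x‖ ^ 2 + ‖x‖ * ‖y‖ + ‖y‖ ^ 2) * ‖x - y‖)
      ≤ B * ((r ^ 2 + r * r + r ^ 2) * ‖x - y‖) := by gcongr
    _ = 3 * B * r ^ 2 * ‖x - y‖ := by ring

lemma continuous_of_cubic (hB : 0 ≤ B)
    (hY : ∀ a b, ‖Y a - Y b‖ ≤ B * ((‖a‖ ^ 2 + ‖a‖ * ‖b‖ + ‖b‖ ^ 2) * ‖a - b‖)) :
    Continuous Y := by
  rw [continuous_iff_continuousAt]
  intro x
  refine (lipschitzOnWith_of_cubic hB hY (‖x‖ + 1)).continuousOn.continuousAt ?_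
  have : {y : E | ‖y‖ < ‖x‖ + 1} ∈ nhds x :=
    (isOpen_lt continuous_norm continuous_const).mem_nhds (by simp)
  refine mem_of_superset this fun y hy => ?_
  rw [Set.mem_ofPred_eq] at hy ⊢
  exact hy.le

variable [NormedSpace ℝ E]

lemma exists_solution_of_cubic [CompleteSpace E] (hB : 0 ≤ B)
    (hY : ∀ a b, ‖Y a - Y b‖ ≤ B * ((‖a‖ ^ 2 + ‖a‖ * ‖b‖ + ‖b‖ ^ 2) * ‖a - b‖)) (h0 : Y 0 = 0)
    {T : ℝ} (hT : 0 ≤ T) {x₀ : E} (hx : 8 * B * ‖x₀‖ ^ 2 * T ≤ 1) :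
    ∃ a : ℝ → E, a 0 = x₀ ∧ Continuous a ∧
      (∀ t ∈ Icc (-T) T, HasDerivWithinAt a (Y (a t)) (Icc (-T) T) t) ∧
      ∀ t, ‖a t‖ ≤ 2 * ‖x₀‖ := by
  have hball : ∀ x ∈ Metric.closedBall x₀ ‖x₀‖, ‖x‖ ≤ 2 * ‖x₀‖ := by
    intro x hx
    rw [mem_closedBall_iff_norm] at hx
    have := norm_le_norm_add_norm_sub x₀ x
    rw [norm_sub_rev] at this
    linarith
  have hPL : IsPicardLindelof (fun _ : ℝ => Y) (⟨0, by simp [hT]⟩ : Icc (-T) T) x₀ ‖x₀‖₊ 0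
      (8 * B * ‖x₀‖ ^ 3).toNNReal (3 * B * (2 * ‖x₀‖) ^ 2).toNNReal := by
    refine IsPicardLindelof.of_time_independent (fun x hx => ?_)
      ((lipschitzOnWith_of_cubic hB hY _).mono fun x hx => hball x hx) ?_
    · have h1 := hball x hx
      have h2 := hY x 0
      simp only [h0, sub_zero, norm_zero, mul_zero, add_zero, ne_eq, OfNat.ofNat_ne_zero,
        not_false_eq_true, zero_pow] at h2
      rw [Real.coe_toNNReal _ (by positivity)]
      calc ‖Y x‖ ≤ B * (‖x‖ ^ 2 * ‖x‖) := h2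
        _ ≤ B * ((2 * ‖x₀‖) ^ 2 * (2 * ‖x₀‖)) := by gcongr
        _ = _ := by ring
    · rw [Real.coe_toNNReal _ (by positivity)]
      simp only [sub_zero, zero_sub, neg_neg, max_self, NNReal.coe_zero, coe_nnnorm]
      nlinarith [norm_nonneg x₀]
  obtain ⟨β, hβ⟩ := ODE.FunSpace.exists_isFixedPt_next hPL (Metric.mem_closedBall_self le_rfl)
  refine ⟨β.compProj, ?_, β.continuous_compProj, fun t ht => ?_, fun t => hball _ ?_⟩
  · have : β.compProj ((⟨0, by simp [hT]⟩ : Icc (-T) T) : ℝ) = x₀ := by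
      rw [ODE.FunSpace.compProj_val, ← hβ, ODE.FunSpace.next_apply₀]
    exact this
  · apply ODE.hasDerivWithinAt_picard_Icc (t₀ := 0) (by simp [hT]) hPL.continuousOn_uncurry
      β.continuous_compProj.continuousOn
      (fun _ ht' ↦ β.compProj_mem_closedBall hPL.mul_max_le) x₀ ht |>.congr_of_mem _ ht
    intro t' ht'
    nth_rw 1 [← hβ]
    rw [ODE.FunSpace.compProj_of_mem ht', ODE.FunSpace.next_apply]
  · exact β.compProj_mem_closedBall hPL.mul_max_le

lemma eqOn_of_cubic (hB : 0 ≤ B)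
    (hY : ∀ a b, ‖Y a - Y b‖ ≤ B * ((‖a‖ ^ 2 + ‖a‖ * ‖b‖ + ‖b‖ ^ 2) * ‖a - b‖))
    {T : ℝ} (hT : 0 < T) {a b : ℝ → E} (hab : a 0 = b 0)
    (ha : ∀ t ∈ Icc (-T) T, HasDerivWithinAt a (Y (a t)) (Icc (-T) T) t)
    (hb : ∀ t ∈ Icc (-T) T, HasDerivWithinAt b (Y (b t)) (Icc (-T) T) t) :
    EqOn a b (Icc (-T) T) := by
  have ca : ContinuousOn a (Icc (-T) T) := fun t ht => (ha t ht).continuousWithinAt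
  have cb : ContinuousOn b (Icc (-T) T) := fun t ht => (hb t ht).continuousWithinAt
  obtain ⟨r₁, h₁⟩ := isCompact_Icc.exists_bound_of_continuousOn ca
  obtain ⟨r₂, h₂⟩ := isCompact_Icc.exists_bound_of_continuousOn cb
  have hsub : Ioo (-T) T ⊆ Icc (-T) T := Ioo_subset_Icc_self
  exact ODE_solution_unique_of_mem_Icc (v := fun _ => Y) (s := fun _ => {x | ‖x‖ ≤ max r₁ r₂})
    (t₀ := 0) (fun t _ => lipschitzOnWith_of_cubic hB hY _) (by simp [hT])
    ca (fun t ht => (ha t (hsub ht)).hasDerivAt (Icc_mem_nhds ht.1 ht.2))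
    (fun t ht => (h₁ t (hsub ht)).trans (le_max_left _ _))
    cb (fun t ht => (hb t (hsub ht)).hasDerivAt (Icc_mem_nhds ht.1 ht.2))
    (fun t ht => (h₂ t (hsub ht)).trans (le_max_right _ _)) hab

end CubicODE

section Transfer

lemma hsE_eq_tsum_enorm (s : ℝ) (u : ℤ → ℂ) :
    hsE s u = (∑' n, ‖(hsWeight s n : ℂ) * u n‖ₑ ^ 2) ^ ((1 : ℝ) / 2) := by
  rw [hsE]
  congr 1
  refine tsum_congr fun n => ?_
  rw [enorm_mul, mul_pow, enorm_eq_nnnorm (u n)]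
  congr 1
  rw [← ofReal_norm, ← ENNReal.ofReal_pow (norm_nonneg _), Complex.norm_real, Real.norm_eq_abs, sq_abs,
    hsWeight, Real.sq_sqrt (by positivity)]

lemma hsE_eq_enorm {s : ℝ} {u : ℤ → ℂ} {a : lp (fun _ : ℤ => ℂ) 2}
    (h : ∀ n, a n = hsWeight s n * u n) : hsE s u = ‖a‖ₑ := by
  rw [hsE_eq_tsum_enorm]
  simp_rw [← h]
  rw [← lp_two_enorm_sq, ← ENNReal.rpow_natCast_mul]
  norm_num

lemma exists_lp_of_hsE_ne_top {s : ℝ} {u : ℤ → ℂ} (h : hsE s u ≠ ⊤) :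
    ∃ a : lp (fun _ : ℤ => ℂ) 2, ∀ n, a n = hsWeight s n * u n := by
  rw [hsE_eq_tsum_enorm] at h
  refine ⟨⟨fun n => hsWeight s n * u n, (memlp_two_iff_tsum_enorm _).mpr fun h2 => h ?_⟩,
    fun n => rfl⟩
  rw [h2, ENNReal.top_rpow_of_pos (by norm_num)]

lemma hasHsDerivWithinAt_iff {s : ℝ} {u : ℝ → ℤ → ℂ} {a : ℝ → lp (fun _ : ℤ => ℂ) 2}
    {d : ℤ → ℂ} {D : lp (fun _ : ℤ => ℂ) 2} {A : Set ℝ} {t : ℝ} (ht : t ∈ A)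
    (hu : ∀ t ∈ A, ∀ n, a t n = hsWeight s n * u t n) (hd : ∀ n, D n = hsWeight s n * d n) :
    HasHsDerivWithinAt s u d A t ↔ HasDerivWithinAt a D A t := by
  have himg : (fun h => t + h) '' {h : ℝ | t + h ∈ A ∧ h ≠ 0} = A \ {t} := by
    ext x
    constructor
    · rintro ⟨h, ⟨h1, h2⟩, rfl⟩
      exact ⟨h1, by simpa using h2⟩
    · rintro ⟨h1, h2⟩
      exact ⟨x - t, ⟨by simpa using h1, sub_ne_zero.mpr h2⟩, by simp⟩
  have hmap : map (fun h => t + h) (nhdsWithin 0 {h : ℝ | t + h ∈ A ∧ h ≠ 0})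
      = nhdsWithin t (A \ {t}) := by
    have := (Homeomorph.addLeft t).isEmbedding.map_nhdsWithin_eq {h : ℝ | t + h ∈ A ∧ h ≠ 0} 0
    simp only [Homeomorph.coe_addLeft, add_zero] at this
    rw [this, himg]
  rw [hasDerivWithinAt_iff_tendsto_slope, ← hmap, tendsto_map'_iff, tendsto_iff_edist_tendsto_0,
    HasHsDerivWithinAt]
  refine tendsto_congr' ?_
  filter_upwards [self_mem_nhdsWithin] with h hh
  rw [edist_eq_enorm_sub]
  refine hsE_eq_enorm fun n => ?_
  have e : slope a t (t + h) = h⁻¹ • (a (t + h) - a t) := by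
    rw [slope_def_module]; simp
  simp only [Function.comp_apply, e, lp.coeFn_sub, lp.coeFn_smul, Pi.sub_apply, Pi.smul_apply,
    hu _ hh.1, hu _ ht, hd, Complex.real_smul, Complex.ofReal_inv]
  ring

end Transfer

/-- The multiplier of the Birkhoff vector field, conjugated by the `H^s` weight. -/
def birkhoffMultiplier (α σ : ℝ) (N : ℕ∞) (s : ℝ) (n : ℤ) (p : ℤ × ℤ) : ℂ :=
  if inBall N n ∧ inBall N p.1 ∧ inBall N p.2 ∧ inBall N (p.1 + p.2 - n) ∧
      res α p.1 p.2 (p.1 + p.2 - n) ≠ 0 then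
    ((hsWeight s n / (hsWeight s p.1 * hsWeight s p.2 * hsWeight s (p.1 + p.2 - n)) *
      (-σ / res α p.1 p.2 (p.1 + p.2 - n)) : ℝ) : ℂ)
  else 0

lemma tri_birkhoffMultiplier {α σ : ℝ} {N : ℕ∞} {s : ℝ} {a u : ℤ → ℂ}
    (h : ∀ n, a n = hsWeight s n * u n) (n : ℤ) :
    tri (birkhoffMultiplier α σ N s) a a a n = hsWeight s n * XB α σ N u n := by
  rw [tri, XB]
  by_cases hn : inBall N n
  · rw [if_pos hn, ← tsum_mul_left]
    refine tsum_congr fun p => ?_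
    rw [birkhoffMultiplier]
    simp only [hn, true_and]
    split_ifs with hc
    · have w1 : (hsWeight s p.1 : ℂ) ≠ 0 := by exact_mod_cast (hsWeight_pos s p.1).ne'
      have w2 : (hsWeight s p.2 : ℂ) ≠ 0 := by exact_mod_cast (hsWeight_pos s p.2).ne'
      have w3 : (hsWeight s (p.1 + p.2 - n) : ℂ) ≠ 0 := by
        exact_mod_cast (hsWeight_pos s (p.1 + p.2 - n)).ne'
      simp only [h, map_mul, Complex.conj_ofReal]
      push_cast
      field_simp
    · simp
  · simp [birkhoffMultiplier, hn]

lemma exists_birkhoffMultiplier_le {α s : ℝ} (hα₁ : 3 / 4 < α) (hα₂ : α ≤ 1)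
    (hs : 2 - 2 * α ≤ s) :
    ∃ κ : ℤ → ℝ≥0∞, ∑' k, κ k ^ 2 ≠ ⊤ ∧ ∀ σ : ℝ, |σ| = 1 → ∀ (N : ℕ∞) (n : ℤ) (p : ℤ × ℤ),
      ‖birkhoffMultiplier α σ N s n p‖ₑ ≤ κ (n - p.1) * κ (n - p.2) := by
  obtain ⟨C, hC, hbound⟩ := exists_hsWeight_le hα₁ hα₂ hs
  refine ⟨fun k => ENNReal.ofReal (Real.sqrt C * |(k : ℝ)| ^ (1 - 2 * α)), ?_, ?_⟩
  · have hsum : Summable fun k : ℤ => C * |(k : ℝ)| ^ (-(4 * α - 2)) :=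
      (Real.summable_abs_int_rpow (by linarith)).mul_left C
    refine ne_of_eq_of_ne (tsum_congr fun k => ?_) hsum.tsum_ofReal_ne_top
    rw [← ENNReal.ofReal_pow (by positivity), mul_pow, Real.sq_sqrt hC.le,
      ← Real.rpow_mul_natCast (abs_nonneg _)]
    congr 3
    push_cast
    ring
  · rintro σ hσ N n ⟨i, j⟩
    rw [birkhoffMultiplier]
    split_ifs with hc
    · obtain ⟨-, -, -, -, hres⟩ := hc
      obtain ⟨l, rfl⟩ : ∃ l, n = i + j - l := ⟨i + j - n, by ring⟩
      simp only [sub_sub_cancel] at hres ⊢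
      have h := hbound i j l hres
      have w1 := hsWeight_pos s i
      have w2 := hsWeight_pos s j
      have w3 := hsWeight_pos s l
      have w := hsWeight_pos s (i + j - l)
      have hr : 0 < |res α i j l| := abs_pos.mpr hres
      rw [← ENNReal.ofReal_mul (by positivity), ← ofReal_norm]
      refine ENNReal.ofReal_le_ofReal ?_
      rw [Complex.norm_real, Real.norm_eq_abs, abs_mul, abs_div, abs_div, abs_neg, hσ,
        abs_of_pos w, abs_of_pos (by positivity : 0 < hsWeight s i * hsWeight s j * hsWeight s l),
        div_mul_div_comm, mul_one, div_le_iff₀ (by positivity)]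
      have e1 : ((i + j - l - i : ℤ) : ℝ) = j - l := by push_cast; ring
      have e2 : ((i + j - l - j : ℤ) : ℝ) = i - l := by push_cast; ring
      rw [e1, e2]
      refine h.trans (le_of_eq ?_)
      have e3 := Real.mul_self_sqrt hC.le
      linear_combination -(|(i : ℝ) - l| ^ (1 - 2 * α) * |(j : ℝ) - l| ^ (1 - 2 * α)) *
        (hsWeight s i * hsWeight s j * hsWeight s l) * |res α i j l| * e3
    · simp

/-- Local well-posedness of the fractional Birkhoff flow in `H^s`, `3/4 < α ≤ 1`,
`s ≥ 2 - 2α`, on the time interval `[-c_α/R², c_α/R²]`. -/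
theorem statement_10 (α : ℝ) (hα₁ : 3/4 < α) (hα₂ : α ≤ 1) (s : ℝ) (hs : 2 - 2*α ≤ s) :
    ∃ cα C : ℝ, 0 < cα ∧ cα < 1 ∧ 0 < C ∧
      ∀ σ : ℝ, (σ = 1 ∨ σ = -1) → ∀ N : ℕ∞, ∀ R : ℝ, 0 < R →
        ∀ u₀ : ℤ → ℂ, hsE s u₀ ≤ ENNReal.ofReal R →
          ∃ u : ℝ → ℤ → ℂ,
            u 0 = u₀ ∧
            IsC1SolOn α σ N s (Set.Icc (-(cα / R^2)) (cα / R^2)) u ∧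
            (∀ t ∈ Set.Icc (-(cα / R^2)) (cα / R^2),
              hsE s (u t) ≤ ENNReal.ofReal C * hsE s u₀) ∧
            ∀ v : ℝ → ℤ → ℂ,
              v 0 = u₀ → IsC1SolOn α σ N s (Set.Icc (-(cα / R^2)) (cα / R^2)) v →
              ∀ t ∈ Set.Icc (-(cα / R^2)) (cα / R^2), v t = u t := by
  obtain ⟨κ, hκ, hm⟩ := exists_birkhoffMultiplier_le hα₁ hα₂ hs
  set B : ℝ := (∑' k, κ k ^ 2).toReal
  have hB : 0 ≤ B := ENNReal.toReal_nonneg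
  refine ⟨1 / (8 * B + 2), 2, by positivity, ?_, two_pos, ?_⟩
  · rw [div_lt_one (by positivity)]; linarith
  intro σ hσ N R hR u₀ hu₀
  obtain ⟨Y, hYtri, hYlip, hY0⟩ :=
    exists_cubic_field (hm σ (by rcases hσ with rfl | rfl <;> simp) N) hκ
  obtain ⟨x₀, hx₀⟩ := exists_lp_of_hsE_ne_top (ne_top_of_le_ne_top ENNReal.ofReal_ne_top hu₀)
  have hnorm : ‖x₀‖ ≤ R := by
    rw [hsE_eq_enorm hx₀, ← ofReal_norm] at hu₀
    exact (ENNReal.ofReal_le_ofReal_iff hR.le).mp hu₀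
  set T : ℝ := 1 / (8 * B + 2) / R ^ 2 with hTdef
  have hT : 0 < T := by positivity
  have hsmall : 8 * B * ‖x₀‖ ^ 2 * T ≤ 1 := by
    calc 8 * B * ‖x₀‖ ^ 2 * T ≤ 8 * B * R ^ 2 * T := by gcongr
      _ = 8 * B / (8 * B + 2) := by rw [hTdef]; field_simp
      _ ≤ 1 := by rw [div_le_one (by positivity)]; linarith
  have hYX : ∀ {a : lp (fun _ : ℤ => ℂ) 2} {u : ℤ → ℂ}, (∀ n, a n = hsWeight s n * u n) →
      ∀ n, Y a n = hsWeight s n * XB α σ N u n := fun h n => by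
    rw [hYtri, tri_birkhoffMultiplier h]
  obtain ⟨a, ha0, hac, had, hab⟩ := exists_solution_of_cubic hB hYlip hY0 hT.le hsmall
  have hW : ∀ n, (hsWeight s n : ℂ) ≠ 0 := fun n => by exact_mod_cast (hsWeight_pos s n).ne'
  have hau : ∀ t n, a t n = hsWeight s n * (a t n / hsWeight s n) := fun t n => by
    rw [mul_div_cancel₀ _ (hW n)]
  refine ⟨fun t n => a t n / hsWeight s n, ?_, ⟨fun t ht => ⟨?_, ?_⟩, fun t ht => ?_⟩,
    fun t ht => ?_, fun v hv0 hv t ht => ?_⟩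
  · funext n
    beta_reduce
    rw [ha0, hx₀, mul_div_cancel_left₀ _ (hW n)]
  · rw [hsE_eq_enorm (hau t)]
    exact enorm_ne_top
  · exact (hasHsDerivWithinAt_iff ht (fun t _ => hau t) (hYX (hau t))).mpr (had t ht)
  · have hc : Continuous fun t => Y (a t) := (continuous_of_cubic hB hYlip).comp hac
    have := tendsto_iff_edist_tendsto_0.mp (hc.continuousWithinAt (s := Icc (-T) T) (x := t))
    refine this.congr fun t' => ?_
    rw [edist_eq_enorm_sub]
    refine (hsE_eq_enorm fun n => ?_).symm
    rw [lp.coeFn_sub, Pi.sub_apply, hYX (hau t'), hYX (hau t), mul_sub]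
  · rw [hsE_eq_enorm (hau t), hsE_eq_enorm hx₀, ← ofReal_norm, ← ofReal_norm,
      ← ENNReal.ofReal_mul two_pos.le]
    exact ENNReal.ofReal_le_ofReal (hab t)
  · have hb : ∀ t, ∃ b : lp (fun _ : ℤ => ℂ) 2, t ∈ Icc (-T) T →
        ∀ n, b n = hsWeight s n * v t n := fun t => by
      by_cases ht : t ∈ Icc (-T) T
      · obtain ⟨b, hb⟩ := exists_lp_of_hsE_ne_top (hv.1 t ht).1
        exact ⟨b, fun _ => hb⟩
      · exact ⟨0, fun h => absurd h ht⟩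
    choose b hb using hb
    have hb0 : a 0 = b 0 := by
      ext n
      rw [ha0, hb 0 (by simp [hT.le]) n, hx₀, hv0]
    have hbd : ∀ t ∈ Icc (-T) T, HasDerivWithinAt b (Y (b t)) (Icc (-T) T) t := fun t ht =>
      (hasHsDerivWithinAt_iff ht hb (hYX (hb t ht))).mp (hv.1 t ht).2
    have heq := eqOn_of_cubic hB hYlip hT hb0 had hbd ht
    funext n
    beta_reduce
    rw [heq, hb t ht n, mul_div_cancel_left₀ _ (hW n)]

end
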